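/- arXiv:1409.5113 — 10 statements merged into one kernel-verified Lean document; each statement's English description precedes it below -/
import Mathlib

section
/- Let X be a spectral space and let Y be a subset of X. Then both patch(Y) and inv(Y), each equipped with the subspace topology induced from X, are spectral spaces. -/
open TopologicalSpace Set

/-- A topological space is *spectral* if it is quasicompact, `T0`, quasi-sober (every nonempty
irreducible closed subset has a generic point), its quasicompact open subsets are closed under
finite intersections (quasi-separatedness) and form a basis for the topology. -/
def IsSpectralTop (X : Type*) [TopologicalSpace X] : Prop :=
  CompactSpace X ∧ T0Space X ∧ QuasiSober X ∧ QuasiSeparatedSpace X ∧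
    IsTopologicalBasis {U : Set X | IsOpen U ∧ IsCompact U}

variable {X : Type*} [TopologicalSpace X]

/-- `invC Y` : the intersection of all quasicompact open subsets of `X` containing `Y`. -/
def invC (Y : Set X) : Set X := ⋂₀ {U : Set X | (IsOpen U ∧ IsCompact U) ∧ Y ⊆ U}

/-- `patchC Y` : the intersection of all subsets of the form `U₁ ∪ U₂ᶜ` containing `Y`, where
`U₁`, `U₂` are quasicompact open subsets of `X`. -/
def patchC (Y : Set X) : Set X :=
  ⋂₀ {S : Set X | (∃ U₁ U₂ : Set X, (IsOpen U₁ ∧ IsCompact U₁) ∧ (IsOpen U₂ ∧ IsCompact U₂) ∧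
      S = U₁ ∪ U₂ᶜ) ∧ Y ⊆ S}

open Topology

theorem isOpen_constructibleTopology_of_isOpen
    (hB : IsTopologicalBasis {U : Set X | IsOpen U ∧ IsCompact U}) {U : Set X} (hU : IsOpen U) :
    IsOpen[constructibleTopology X] U := by
  obtain ⟨S, hS, rfl⟩ := hB.open_eq_sUnion hU
  exact @isOpen_sUnion X (constructibleTopology X) S fun s hs =>
    (hS hs).2.isOpen_constructibleTopology_of_isOpen (hS hs).1

theorem isClosed_constructibleTopology_of_isOpen_of_isCompact {U : Set X} (hU : IsOpen U)
    (hc : IsCompact U) : IsClosed[constructibleTopology X] U :=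
  (@isOpen_compl_iff X U (constructibleTopology X)).1 <|
    IsCompact.isOpen_constructibleTopology_of_isClosed ((compl_compl U).symm ▸ hc)
      hU.isClosed_compl

theorem IsSpectralTop.isCompact_constructibleTopology (hX : IsSpectralTop X) {Z : Set X}
    (hZ : IsClosed[constructibleTopology X] Z) : @IsCompact X (constructibleTopology X) Z := by
  obtain ⟨_, _, _, _, hB⟩ := hX
  have : PrespectralSpace X := ⟨hB⟩
  have : @CompactSpace X (constructibleTopology X) :=
    @Function.Surjective.compactSpace _ _ _ (constructibleTopology X) _
      (WithTopology.continuous_ofTopology _) inferInstance (WithTopology.ofTopology_surjective _)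
  exact @IsClosed.isCompact X (constructibleTopology X) _ this hZ

theorem IsSpectralTop.isCompact_of_isClosed_constructibleTopology (hX : IsSpectralTop X)
    {Z : Set X} (hZ : IsClosed[constructibleTopology X] Z) : IsCompact Z := by
  have hle : constructibleTopology X ≤ ‹TopologicalSpace X› := fun U hU =>
    isOpen_constructibleTopology_of_isOpen hX.2.2.2.2 hU
  simpa using @IsCompact.image X X (constructibleTopology X) _ Z id
    (hX.isCompact_constructibleTopology hZ) (continuous_id_of_le hle)

/-- A subset closed in the constructible topology of a spectral space contains a generic point of
each of its nonempty irreducible relatively closed subsets. -/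
theorem IsSpectralTop.quasiSober_of_isClosed_constructibleTopology (hX : IsSpectralTop X)
    {Z : Set X} (hZ : IsClosed[constructibleTopology X] Z) : QuasiSober Z := by
  have hB := hX.2.2.2.2
  have := hX.2.2.1
  refine ⟨fun {S} hS hSc => ?_⟩
  set C : Set X := (↑) '' S
  obtain ⟨x, hx⟩ := QuasiSober.sober
    (hS.image _ continuous_subtype_val.continuousOn).closure isClosed_closure
  have hCeq : closure C ∩ Z = C := by
    obtain ⟨T, hT, rfl⟩ := isClosed_induced_iff.1 hSc
    refine subset_antisymm ?_ fun y hy => ⟨subset_closure hy, ?_⟩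
    · rintro y ⟨hy, hyZ⟩
      exact ⟨⟨y, hyZ⟩, closure_minimal (by rintro _ ⟨w, hw, rfl⟩; exact hw) hT hy, rfl⟩
    · obtain ⟨w, -, rfl⟩ := hy
      exact w.2
  have hCc : IsClosed[constructibleTopology X] C := by
    rw [← hCeq]
    refine @IsClosed.inter X _ _ (constructibleTopology X) ?_ hZ
    exact (@isOpen_compl_iff X _ (constructibleTopology X)).1
      (isOpen_constructibleTopology_of_isOpen hB isClosed_closure.isOpen_compl)
  have hne : (nhds x ⊓ Filter.principal C).NeBot :=
    mem_closure_iff_clusterPt.1 hx.mem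
  obtain ⟨z, hzC, hz⟩ := hX.isCompact_constructibleTopology hCc
    (f := nhds x ⊓ Filter.principal C) inf_le_right
  have hzx : z ⤳ x := by
    rw [specializes_iff_forall_open]
    intro V hV hxV
    obtain ⟨U, ⟨hU, hUc⟩, hxU, hUV⟩ := hB.exists_subset_of_mem_open hxV hV
    refine hUV ?_
    rw [← @IsClosed.closure_eq X (constructibleTopology X) U
      (isClosed_constructibleTopology_of_isOpen_of_isCompact hU hUc)]
    refine (@mem_closure_iff_clusterPt X (constructibleTopology X) z U).2 ?_
    exact @ClusterPt.mono X (constructibleTopology X) z _ _ hz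
      (inf_le_left.trans (Filter.le_principal_iff.2 (hU.mem_nhds hxU)))
  obtain ⟨w, hwS, rfl⟩ := hzC
  refine ⟨w, subset_antisymm (closure_minimal (singleton_subset_iff.2 hwS) hSc) fun y hy => ?_⟩
  refine specializes_iff_mem_closure.1 ((subtype_specializes_iff _ _).2 (hzx.trans ?_))
  exact specializes_iff_mem_closure.2 (hx.def.symm ▸ subset_closure ⟨y, hy, rfl⟩)

theorem IsSpectralTop.of_isClosed_constructibleTopology (hX : IsSpectralTop X) {Z : Set X}
    (hZ : IsClosed[constructibleTopology X] Z) : IsSpectralTop Z := by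
  have hsober := hX.quasiSober_of_isClosed_constructibleTopology hZ
  have hcpt {U : Set X} (hU : IsOpen U) (hUc : IsCompact U) :
      IsCompact ((↑) ⁻¹' U : Set Z) := by
    rw [Subtype.isCompact_iff, Subtype.image_preimage_coe]
    exact hX.isCompact_of_isClosed_constructibleTopology
      (@IsClosed.inter X _ _ (constructibleTopology X) hZ
        (isClosed_constructibleTopology_of_isOpen_of_isCompact hU hUc))
  have hZc := isCompact_iff_compactSpace.1 (hX.isCompact_of_isClosed_constructibleTopology hZ)
  obtain ⟨_, _, _, _, hB⟩ := hX
  have hBZ : IsTopologicalBasis {U : Set Z | IsOpen U ∧ IsCompact U} := by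
    refine isTopologicalBasis_of_isOpen_of_nhds (fun U hU => hU.1) ?_
    intro a V ha hV
    obtain ⟨W, hW, rfl⟩ := isOpen_induced_iff.1 hV
    obtain ⟨U, ⟨hU, hUc⟩, haU, hUW⟩ := hB.exists_subset_of_mem_open ha hW
    exact ⟨_, ⟨hU.preimage continuous_subtype_val, hcpt hU hUc⟩, haU, preimage_mono hUW⟩
  have hext {V : Set Z} (hV : IsOpen V) (hVc : IsCompact V) :
      ∃ U : Set X, IsOpen U ∧ IsCompact U ∧ (↑) ⁻¹' U = V := by
    obtain ⟨W, hW, rfl⟩ := isOpen_induced_iff.1 hV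
    have : PrespectralSpace X := ⟨hB⟩
    obtain ⟨U, hUc, hU, hVU, hUW⟩ := PrespectralSpace.exists_isCompact_and_isOpen_between
      (Subtype.isCompact_iff.1 hVc) hW (image_preimage_subset _ _)
    exact ⟨U, hU, hUc, subset_antisymm (preimage_mono hUW) (image_subset_iff.1 hVU)⟩
  refine ⟨hZc, inferInstance, hsober, ⟨fun V₁ V₂ h₁ hc₁ h₂ hc₂ => ?_⟩, hBZ⟩
  obtain ⟨U₁, hU₁, hUc₁, rfl⟩ := hext h₁ hc₁
  obtain ⟨U₂, hU₂, hUc₂, rfl⟩ := hext h₂ hc₂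
  rw [← preimage_inter]
  exact hcpt (hU₁.inter hU₂)
    (QuasiSeparatedSpace.inter_isCompact U₁ U₂ hU₁ hUc₁ hU₂ hUc₂)

theorem isClosed_constructibleTopology_invC (Y : Set X) :
    IsClosed[constructibleTopology X] (invC Y) :=
  @isClosed_sInter X (constructibleTopology X) _ fun _ hU =>
    isClosed_constructibleTopology_of_isOpen_of_isCompact hU.1.1 hU.1.2

theorem isClosed_constructibleTopology_patchC (Y : Set X) :
    IsClosed[constructibleTopology X] (patchC Y) := by
  refine @isClosed_sInter X (constructibleTopology X) _ ?_
  rintro _ ⟨⟨U₁, U₂, ⟨h₁, hc₁⟩, ⟨h₂, hc₂⟩, rfl⟩, -⟩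
  refine @IsClosed.union X _ _ (constructibleTopology X)
    (isClosed_constructibleTopology_of_isOpen_of_isCompact h₁ hc₁) ?_
  exact (@isClosed_compl_iff X (constructibleTopology X) U₂).2
    (hc₂.isOpen_constructibleTopology_of_isOpen h₂)

/-- patch(Y) and inv(Y), with the subspace topology induced from the spectral space `X`,
are spectral spaces. -/
theorem stmt0 (hX : IsSpectralTop X) (Y : Set X) :
    IsSpectralTop ↥(patchC Y) ∧ IsSpectralTop ↥(invC Y) :=
  ⟨hX.of_isClosed_constructibleTopology (isClosed_constructibleTopology_patchC Y),
    hX.of_isClosed_constructibleTopology (isClosed_constructibleTopology_invC Y)⟩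
end

section
/- Let X be a spectral space and let Y be a subset of X. Then inv(Y) = gen(pt(Y)) = gen(patch(Y)). -/
open TopologicalSpace Set

variable {X : Type*} [TopologicalSpace X]

/-- `genC Y` : the set of all generalizations of points of `Y`,
i.e. `{x : cl({x}) ∩ Y ≠ ∅}`. -/
def genC (Y : Set X) : Set X := {x : X | (closure {x} ∩ Y).Nonempty}

/-- `ptC Y` : the set of points of `invC Y` that are closed in the subspace topology
of `invC Y`. -/
def ptC (Y : Set X) : Set X :=
  {x : X | ∃ h : x ∈ invC Y, IsClosed ({⟨x, h⟩} : Set ↥(invC Y))}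

/-- Quasicompact open sets are clopen in the constructible topology. -/
lemma isClopen_preimage_ofTopology_constructible {U : Set X} (ho : IsOpen U) (hc : IsCompact U) :
    IsClopen (WithTopology.ofTopology (t := constructibleTopology X) ⁻¹' U) := by
  refine ⟨⟨WithConstructibleTopology.isOpen_iff.2 ?_⟩, WithConstructibleTopology.isOpen_iff.2 ?_⟩
  · exact IsCompact.isOpen_constructibleTopology_of_isClosed (s := Uᶜ) (by rwa [compl_compl])
      ho.isClosed_compl
  · exact hc.isOpen_constructibleTopology_of_isOpen ho

/-- The identity map from the constructible topology of a prespectral space is continuous. -/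
lemma continuous_ofTopology_constructible [PrespectralSpace X] :
    Continuous (WithTopology.ofTopology (t := constructibleTopology X)) :=
  PrespectralSpace.isTopologicalBasis.continuous_iff.2 fun _ hU ↦
    (isClopen_preimage_ofTopology_constructible hU.1 hU.2).isOpen

/-- In a spectral space, an intersection of sets of the form `U₁ ∪ U₂ᶜ`, with `U₁` and `U₂`
quasicompact open, is quasicompact. -/
lemma isCompact_sInter_union_compl [SpectralSpace X] (F : Set (Set X))
    (hF : ∀ S ∈ F, ∃ U₁ U₂ : Set X, (IsOpen U₁ ∧ IsCompact U₁) ∧ (IsOpen U₂ ∧ IsCompact U₂) ∧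
      S = U₁ ∪ U₂ᶜ) : IsCompact (⋂₀ F) := by
  have hclosed : IsClosed (WithTopology.ofTopology (t := constructibleTopology X) ⁻¹' ⋂₀ F) := by
    rw [preimage_sInter]
    refine isClosed_biInter fun S hS ↦ ?_
    obtain ⟨U₁, U₂, ⟨ho₁, hc₁⟩, ⟨ho₂, hc₂⟩, rfl⟩ := hF S hS
    exact (isClopen_preimage_ofTopology_constructible ho₁ hc₁).isClosed.union
      (isClopen_preimage_ofTopology_constructible ho₂ hc₂).compl.isClosed
  rw [← image_preimage_eq (⋂₀ F) (WithTopology.ofTopology_surjective (constructibleTopology X))]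
  exact hclosed.isCompact.image continuous_ofTopology_constructible

lemma subset_patchC (Y : Set X) : Y ⊆ patchC Y :=
  subset_sInter fun _ hS ↦ hS.2

lemma patchC_subset_invC [CompactSpace X] (Y : Set X) : patchC Y ⊆ invC Y :=
  subset_sInter fun U hU ↦ sInter_subset_of_mem
    ⟨⟨U, univ, hU.1, ⟨isOpen_univ, isCompact_univ⟩, by simp⟩, hU.2⟩

lemma isCompact_patchC [SpectralSpace X] (Y : Set X) : IsCompact (patchC Y) :=
  isCompact_sInter_union_compl _ fun _ hS ↦ hS.1

lemma isCompact_invC [SpectralSpace X] (Y : Set X) : IsCompact (invC Y) :=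
  isCompact_sInter_union_compl _ fun U hU ↦
    ⟨U, univ, hU.1, ⟨isOpen_univ, isCompact_univ⟩, by simp⟩

lemma genC_subset_invC {Y Z : Set X} (hZ : Z ⊆ invC Y) : genC Z ⊆ invC Y := by
  rintro x ⟨z, hxz, hz⟩ U hU
  exact (specializes_iff_mem_closure.2 hxz).mem_open hU.1.1 (hZ hz U hU)

lemma invC_subset_genC_patchC [SpectralSpace X] (Y : Set X) : invC Y ⊆ genC (patchC Y) := by
  intro x hx
  by_contra hne
  have hsub : patchC Y ⊆ (closure {x})ᶜ := fun z hz hzx ↦ hne ⟨z, hzx, hz⟩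
  obtain ⟨V, hVc, hVo, hYV, hVx⟩ := PrespectralSpace.exists_isCompact_and_isOpen_between
    (isCompact_patchC Y) isClosed_closure.isOpen_compl hsub
  exact hVx (hx V ⟨⟨hVo, hVc⟩, (subset_patchC Y).trans hYV⟩) (subset_closure rfl)

lemma invC_subset_genC_ptC [SpectralSpace X] (Y : Set X) : invC Y ⊆ genC (ptC Y) := by
  intro x hx
  have : CompactSpace (invC Y) := isCompact_iff_compactSpace.1 (isCompact_invC Y)
  obtain ⟨⟨z, hz⟩, hzx, hzc⟩ := (isClosed_closure (s := {x})).preimage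
    (continuous_subtype_val (p := (· ∈ invC Y))) |>.exists_closed_singleton
      ⟨⟨x, hx⟩, subset_closure rfl⟩
  exact ⟨z, hzx, hz, hzc⟩

/-- For a subset `Y` of a spectral space `X`: `inv(Y) = gen(pt(Y)) = gen(patch(Y))`. -/
theorem stmt2 (hX : IsSpectralTop X) (Y : Set X) :
    invC Y = genC (ptC Y) ∧ invC Y = genC (patchC Y) := by
  obtain ⟨_, _, _, _, hB⟩ := hX
  have : PrespectralSpace X := ⟨hB⟩
  have : SpectralSpace X := {}
  exact ⟨(invC_subset_genC_ptC Y).antisymm (genC_subset_invC fun _ hx ↦ hx.1),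
    (invC_subset_genC_patchC Y).antisymm (genC_subset_invC (patchC_subset_invC Y))⟩
end

section
/- Let X be an irreducible spectral space and let Y be a nonempty subset of X that is an intersection of quasicompact open subsets of X (i.e., Y is closed in the inverse topology on X). Then Y is an irreducible topological space in the subspace topology. -/
open TopologicalSpace Set

variable {X : Type*} [TopologicalSpace X]

/-- A nonempty subset of an irreducible spectral space which is an intersection of
quasicompact open subsets (i.e. closed in the inverse topology) is irreducible. -/
theorem stmt5 (hX : IsSpectralTop X) (hirr : IrreducibleSpace X) (Y : Set X)
    (hne : Y.Nonempty)
    (hY : ∃ 𝒰 : Set (Set X), (∀ U ∈ 𝒰, IsOpen U ∧ IsCompact U) ∧ Y = ⋂₀ 𝒰) :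
    IsIrreducible Y := by
  obtain ⟨-, -, hsober, -, -⟩ := hX
  obtain ⟨𝒰, h𝒰, rfl⟩ := hY
  have mem_of_open {U : Set X} (hU : IsOpen U) (hU' : U.Nonempty) : genericPoint X ∈ U :=
    (genericPoint_spec X).mem_open_set_iff hU |>.2 (by simpa using hU')
  have hη : genericPoint X ∈ ⋂₀ 𝒰 := fun U hU =>
    mem_of_open (h𝒰 U hU).1 (hne.mono (sInter_subset_of_mem hU))
  exact ⟨hne, fun u v hu hv hYu hYv =>
    ⟨genericPoint X, hη, mem_of_open hu hYu.right, mem_of_open hv hYv.right⟩⟩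
end

section
/- Let X be a spectral space and let Y be a retrocompact subset of X. Then patch(Y) = {x ∈ X : cl({x}) = cl(Z) for some subset Z of Y}, i.e., patch(Y) is exactly the set of points of X that are generic points of some subset of Y. -/
open TopologicalSpace Set

variable {X : Type*} [TopologicalSpace X]

/-- If `Y` is a retrocompact subset of a spectral space `X`, then `patch(Y)` is exactly the
set of points of `X` that are generic points of some subset of `Y`. -/
theorem stmt7 (hX : IsSpectralTop X) (Y : Set X)
    (hretro : ∀ U : Set X, IsOpen U → IsCompact U → IsCompact (Y ∩ U)) :
    patchC Y = {x : X | ∃ Z ⊆ Y, closure ({x} : Set X) = closure Z} := by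
  obtain ⟨-, -, -, -, hbasis⟩ := hX
  have : PrespectralSpace X := ⟨hbasis⟩
  ext x
  constructor
  · intro hx
    refine ⟨closure {x} ∩ Y, inter_subset_right, (closure_minimal ?_ isClosed_closure).antisymm
      (closure_minimal inter_subset_left isClosed_closure)⟩
    rw [singleton_subset_iff, hbasis.mem_closure_iff]
    intro U hU hxU
    by_contra hempty
    obtain ⟨V, hVc, hVo, hYV, hVx⟩ := PrespectralSpace.exists_isCompact_and_isOpen_between
      (hretro U hU.1 hU.2) isClosed_closure.isOpen_compl fun y hy hyx ↦ hempty ⟨y, hy.2, hyx, hy.1⟩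
    have hxVU : x ∈ V ∪ Uᶜ := hx _ ⟨⟨V, U, ⟨hVo, hVc⟩, hU, rfl⟩, fun y hy ↦
      (em (y ∈ U)).imp (fun hyU ↦ hYV ⟨hy, hyU⟩) id⟩
    exact hxVU.elim (fun hxV ↦ hVx hxV (subset_closure rfl)) (fun hxU' ↦ hxU' hxU)
  · rintro ⟨Z, hZY, hxZ⟩ _ ⟨⟨U₁, U₂, hU₁, hU₂, rfl⟩, hY⟩
    refine or_iff_not_imp_right.mpr fun hxU₂ ↦ ?_
    have hx : x ∈ closure Z := hxZ ▸ subset_closure rfl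
    obtain ⟨z, hzU₂, hzZ⟩ := mem_closure_iff.mp hx U₂ hU₂.1 (not_not.mp hxU₂)
    have hzU₁ : z ∈ U₁ := (hY (hZY hzZ)).resolve_right (not_not.mpr hzU₂)
    have hz : z ∈ closure {x} := hxZ ▸ subset_closure hzZ
    obtain ⟨_, hx', rfl⟩ := mem_closure_iff.mp hz U₁ hU₁.1 hzU₁
    exact hx'
end

section
/- Let d : Y → X be a spectral map between spectral spaces and let Z be a subset of Y. Then d(gen(Z)) ⊆ gen(d(Z)), d(inv(Z)) ⊆ inv(d(Z)), and d(patch(Z)) = patch(d(Z)), where the operators on the left are taken in Y and those on the right in X. -/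
open TopologicalSpace Set

variable {X : Type*} [TopologicalSpace X]

/-- Every ultrafilter on a spectral space converges in the constructible topology. -/
lemma IsSpectralTop.exists_forall_mem_iff (hX : IsSpectralTop X) (f : Ultrafilter X) :
    ∃ x : X, ∀ U : Set X, IsOpen U → IsCompact U → (U ∈ f ↔ x ∈ U) := by
  obtain ⟨_, _, _, _, hb⟩ := hX
  have : PrespectralSpace X := ⟨hb⟩
  let φ : X → WithConstructibleTopology X := WithTopology.toTopology _
  obtain ⟨w, -, hw⟩ := isCompact_univ.ultrafilter_le_nhds (f.map φ) (by simp)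
  obtain ⟨x, rfl⟩ : ∃ x, φ x = w := WithTopology.toTopology_surjective _ w
  have hφ : Function.Injective φ := WithTopology.toTopology_injective _
  have key (s : Set X) (hs : @IsOpen X (constructibleTopology X) s) (hx : x ∈ s) : s ∈ f := by
    have ho : IsOpen (φ '' s) := by
      rw [WithConstructibleTopology.isOpen_iff]
      exact (preimage_image_eq s hφ).symm ▸ hs
    have h : φ ⁻¹' (φ '' s) ∈ f := hw (ho.mem_nhds (mem_image_of_mem φ hx))
    rwa [preimage_image_eq s hφ] at h
  refine ⟨x, fun U hU hc ↦ ⟨fun h ↦ ?_, key U (hc.isOpen_constructibleTopology_of_isOpen hU)⟩⟩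
  by_contra hx
  exact Ultrafilter.compl_mem_iff_notMem.1 (key Uᶜ
    (IsCompact.isOpen_constructibleTopology_of_isClosed (by rwa [compl_compl])
      hU.isClosed_compl) hx) h

lemma TopologicalSpace.IsTopologicalBasis.eq_of_forall_mem_iff [T0Space X] {B : Set (Set X)}
    (hB : IsTopologicalBasis B) {x y : X} (h : ∀ U ∈ B, x ∈ U ↔ y ∈ U) : x = y :=
  (hB.inseparable_iff.2 h).eq

lemma mem_patchC_iff {Z : Set X} {x : X} :
    x ∈ patchC Z ↔ ∀ U V : Set X, IsOpen U → IsCompact U → IsOpen V → IsCompact V →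
      Z ⊆ U ∪ Vᶜ → x ∈ U ∪ Vᶜ := by
  refine ⟨fun h U V hU hU' hV hV' hZ ↦ h _ ⟨⟨U, V, ⟨hU, hU'⟩, ⟨hV, hV'⟩, rfl⟩, hZ⟩, ?_⟩
  rintro h _ ⟨⟨U, V, hU, hV, rfl⟩, hZ⟩
  exact h U V hU.1 hU.2 hV.1 hV.2 hZ

lemma image_genC_subset {Y : Type*} [TopologicalSpace Y] {d : Y → X} (hd : Continuous d)
    (Z : Set Y) : d '' genC Z ⊆ genC (d '' Z) := by
  rintro _ ⟨y, ⟨z, hz, hzZ⟩, rfl⟩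
  exact ⟨d z, ((specializes_iff_mem_closure.2 hz).map hd).mem_closure, mem_image_of_mem d hzZ⟩

lemma image_invC_subset {Y : Type*} [TopologicalSpace Y] {d : Y → X} (hd : IsSpectralMap d)
    (Z : Set Y) : d '' invC Z ⊆ invC (d '' Z) := by
  rintro _ ⟨y, hy, rfl⟩ U ⟨⟨hU, hc⟩, hZ⟩
  exact hy (d ⁻¹' U) ⟨⟨hU.preimage hd.continuous, hc.preimage_of_isOpen hd hU⟩,
    image_subset_iff.1 hZ⟩

lemma image_patchC_subset {Y : Type*} [TopologicalSpace Y] {d : Y → X} (hd : IsSpectralMap d)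
    (Z : Set Y) : d '' patchC Z ⊆ patchC (d '' Z) := by
  rintro _ ⟨y, hy, rfl⟩
  rw [mem_patchC_iff] at hy ⊢
  intro U V hU hU' hV hV' hZ
  have hZd : Z ⊆ d ⁻¹' (U ∪ Vᶜ) := image_subset_iff.1 hZ
  exact hy (d ⁻¹' U) (d ⁻¹' V) (hU.preimage hd.continuous) (hU'.preimage_of_isOpen hd hU)
    (hV.preimage hd.continuous) (hV'.preimage_of_isOpen hd hV) hZd

/-- A point in the patch closure of an image is a constructible limit of the image of an ultrafilter
containing the original set. -/
lemma exists_ultrafilter_of_mem_patchC_image {Y : Type*} [CompactSpace X] [QuasiSeparatedSpace X]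
    {d : Y → X} {Z : Set Y} {x : X} (hx : x ∈ patchC (d '' Z)) :
    ∃ f : Ultrafilter Y, Z ∈ f ∧
      ∀ U : Set X, IsOpen U → IsCompact U → (d ⁻¹' U ∈ f ↔ x ∈ U) := by
  let ι := {p : Set X × Set X // (IsOpen p.1 ∧ IsCompact p.1 ∧ x ∉ p.1) ∧
    (IsOpen p.2 ∧ IsCompact p.2 ∧ x ∈ p.2)}
  let s : ι → Set Y := fun p ↦ Z ∩ d ⁻¹' (p.1.2 \ p.1.1)
  have hne (p : ι) : (s p).Nonempty := by
    obtain ⟨⟨U, V⟩, ⟨hU, hU', hxU⟩, hV, hV', hxV⟩ := p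
    by_contra hemp
    have := mem_patchC_iff.1 hx U V hU hU' hV hV' <| by
      rintro _ ⟨z, hz, rfl⟩
      by_contra hn
      simp only [mem_union, mem_compl_iff, not_or, not_not] at hn
      exact hemp ⟨z, hz, hn.2, hn.1⟩
    exact this.elim hxU fun h ↦ h hxV
  have hdir : Directed (· ≥ ·) fun p ↦ Filter.principal (s p) := by
    rintro ⟨⟨U, V⟩, ⟨hU, hU', hxU⟩, hV, hV', hxV⟩ ⟨⟨U₁, V₁⟩, ⟨hU₁, hU₁', hxU₁⟩, hV₁, hV₁', hxV₁⟩
    refine ⟨⟨⟨U ∪ U₁, V ∩ V₁⟩, ⟨hU.union hU₁, hU'.union hU₁', fun h ↦ h.elim hxU hxU₁⟩,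
      hV.inter hV₁, hV'.inter_of_isOpen hV₁' hV hV₁, hxV, hxV₁⟩, ?_, ?_⟩ <;>
    · simp only [ge_iff_le, Filter.le_principal_iff, Filter.mem_principal, s]
      grind
  let p₀ : ι := ⟨⟨∅, univ⟩, by simp [isCompact_univ]⟩
  have : Nonempty ι := ⟨p₀⟩
  have hF : (⨅ p, Filter.principal (s p)).NeBot :=
    Filter.iInf_neBot_of_directed' hdir fun p ↦ Filter.principal_neBot_iff.2 (hne p)
  let f := Ultrafilter.of (⨅ p, Filter.principal (s p))
  have hf (p : ι) : s p ∈ f :=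
    Ultrafilter.of_le _ (Filter.mem_iInf_of_mem p (Filter.mem_principal_self _))
  refine ⟨f, Filter.mem_of_superset (hf p₀) inter_subset_left, fun U hU hc ↦ ⟨fun h ↦ ?_, ?_⟩⟩
  · by_contra hxU
    have hc' : (d ⁻¹' U)ᶜ ∈ f := Filter.mem_of_superset
      (hf ⟨⟨U, univ⟩, ⟨hU, hc, hxU⟩, by simp [isCompact_univ]⟩) fun y hy ↦ hy.2.2
    exact Ultrafilter.compl_mem_iff_notMem.1 hc' h
  · intro hxU
    exact Filter.mem_of_superset
      (hf ⟨⟨∅, U⟩, by simp, hU, hc, hxU⟩) fun y hy ↦ hy.2.1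

lemma patchC_image_subset {Y : Type*} [TopologicalSpace Y] (hX : IsSpectralTop X)
    (hY : IsSpectralTop Y) {d : Y → X} (hd : IsSpectralMap d) (Z : Set Y) :
    patchC (d '' Z) ⊆ d '' patchC Z := by
  intro x hx
  obtain ⟨_, _, _, _, hb⟩ := hX
  obtain ⟨f, hZf, hf⟩ := exists_ultrafilter_of_mem_patchC_image hx
  obtain ⟨y, hy⟩ := hY.exists_forall_mem_iff f
  refine ⟨y, ?_, hb.eq_of_forall_mem_iff fun U ⟨hU, hc⟩ ↦ ?_⟩
  · rw [mem_patchC_iff]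
    intro U V hU hU' hV hV' hZ
    rw [mem_union, mem_compl_iff, ← hy U hU hU', ← hy V hV hV',
      ← Ultrafilter.compl_mem_iff_notMem, ← Ultrafilter.union_mem_iff]
    exact Filter.mem_of_superset hZf hZ
  · rw [← hf U hU hc]
    exact (hy (d ⁻¹' U) (hU.preimage hd.continuous) (hc.preimage_of_isOpen hd hU)).symm

/-- For a spectral map `d : Y → X` between spectral spaces and `Z ⊆ Y`:
`d(gen(Z)) ⊆ gen(d(Z))`, `d(inv(Z)) ⊆ inv(d(Z))` and `d(patch(Z)) = patch(d(Z))`. -/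
theorem stmt9 {Y : Type*} [TopologicalSpace Y] (hX : IsSpectralTop X) (hY : IsSpectralTop Y)
    (d : Y → X) (hd : IsSpectralMap d) (Z : Set Y) :
    d '' genC Z ⊆ genC (d '' Z) ∧ d '' invC Z ⊆ invC (d '' Z) ∧
      d '' patchC Z = patchC (d '' Z) := by
  exact ⟨image_genC_subset hd.continuous Z, image_invC_subset hd Z,
    (image_patchC_subset hd Z).antisymm (patchC_image_subset hX hY hd Z)⟩
end

section
/- Let d : Y → X be a spectral map between spectral spaces and let Z be a subset of Y. Then every point x ∈ X that is a generic point of some subset of d(Z), i.e. such that cl({x}) = cl(W) for some W ⊆ d(Z), belongs to d(patch(Z)). -/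
open TopologicalSpace Set

variable {X : Type*} [TopologicalSpace X]

open scoped Topology in
/-- Every ultrafilter on a spectral space converges in the constructible topology. -/
theorem IsSpectralTop.exists_forall_mem_ultrafilter_iff (hX : IsSpectralTop X)
    (f : Ultrafilter X) :
    ∃ y : X, ∀ U : Set X, IsOpen U → IsCompact U → (U ∈ f ↔ y ∈ U) := by
  obtain ⟨_, _, _, _, hB⟩ := hX
  have : PrespectralSpace X := ⟨hB⟩
  have key : ∃ y : X, (f : Filter X) ≤ @nhds X (constructibleTopology X) y := by
    have : CompactSpace (WithConstructibleTopology X) := inferInstance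
    let := constructibleTopology X
    have : CompactSpace X :=
      (WithTopology.ofTopology_surjective _).compactSpace (WithTopology.continuous_ofTopology _)
    exact ⟨f.lim, f.le_nhds_lim⟩
  obtain ⟨y, hy⟩ := key
  have mem_of_isOpen {S : Set X} (hS : IsOpen[constructibleTopology X] S) (hyS : y ∈ S) : S ∈ f :=
    hy (@IsOpen.mem_nhds X (constructibleTopology X) _ _ hS hyS)
  refine ⟨y, fun U hU hUc ↦ ⟨fun hUf ↦ ?_,
    mem_of_isOpen (hUc.isOpen_constructibleTopology_of_isOpen hU)⟩⟩
  by_contra hyU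
  have hcompl : IsOpen[constructibleTopology X] Uᶜ :=
    IsCompact.isOpen_constructibleTopology_of_isClosed (by rwa [compl_compl]) hU.isClosed_compl
  exact Ultrafilter.compl_mem_iff_notMem.mp (mem_of_isOpen hcompl hyU) hUf

/-- For a spectral map `d : Y → X` between spectral spaces and `Z ⊆ Y`, every point of `X`
that is a generic point of some subset of `d(Z)` lies in `d(patch(Z))`. -/
theorem stmt11 {Y : Type*} [TopologicalSpace Y] (hX : IsSpectralTop X) (hY : IsSpectralTop Y)
    (d : Y → X) (hd : IsSpectralMap d) (Z : Set Y) (x : X) (W : Set X) (hW : W ⊆ d '' Z)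
    (hx : closure ({x} : Set X) = closure W) :
    x ∈ d '' patchC Z := by
  obtain ⟨_, _, _, _, hB⟩ := hX
  have hne : (Filter.comap d (nhds x) ⊓ Filter.principal (Z ∩ d ⁻¹' W)).NeBot := by
    rw [Filter.inf_principal_neBot_iff]
    intro S hS
    obtain ⟨N, hN, hNS⟩ := Filter.mem_comap.mp hS
    have hxW : x ∈ closure W := hx ▸ subset_closure (mem_singleton x)
    obtain ⟨w, hwN, hwW⟩ := mem_closure_iff_nhds.mp hxW N hN
    obtain ⟨z, hz, rfl⟩ := hW hwW
    exact ⟨z, hNS hwN, hz, hwW⟩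
  let f := Ultrafilter.of (Filter.comap d (nhds x) ⊓ Filter.principal (Z ∩ d ⁻¹' W))
  have hf := Ultrafilter.of_le (Filter.comap d (nhds x) ⊓ Filter.principal (Z ∩ d ⁻¹' W))
  have hZW : Z ∩ d ⁻¹' W ∈ f := hf (Filter.mem_inf_of_right (Filter.mem_principal_self _))
  obtain ⟨y, hy⟩ := hY.exists_forall_mem_ultrafilter_iff f
  refine ⟨y, ?_, ?_⟩
  · rintro _ ⟨⟨U₁, U₂, hU₁, hU₂, rfl⟩, hZ⟩
    have hmem : U₁ ∪ U₂ᶜ ∈ f := Filter.mem_of_superset hZW (inter_subset_left.trans hZ)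
    rw [Ultrafilter.union_mem_iff, Ultrafilter.compl_mem_iff_notMem, hy U₁ hU₁.1 hU₁.2,
      hy U₂ hU₂.1 hU₂.2] at hmem
    exact hmem
  · refine hB.eq_iff.mpr fun U hU ↦ ?_
    change y ∈ d ⁻¹' U ↔ x ∈ U
    rw [← hy _ (hU.1.preimage hd.continuous) (hd.isCompact_preimage_of_isOpen hU.1 hU.2)]
    refine ⟨fun hUf ↦ ?_, fun hxU ↦
      hf (Filter.mem_inf_of_left (Filter.preimage_mem_comap (hU.1.mem_nhds hxU)))⟩
    obtain ⟨z, hzU, -, hzW⟩ := f.nonempty_of_mem (Filter.inter_mem hUf hZW)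
    have hzx : d z ∈ closure ({x} : Set X) := hx ▸ subset_closure hzW
    obtain ⟨_, hxU, rfl⟩ := mem_closure_iff.mp hzx U hU.1 hzU
    exact hxU
end

section
/- Let d : Y → X be a spectral map between spectral spaces, let Z be a subset of Y, and suppose X is a Noetherian space. Then pt(d(Z)) is exactly the set of points of d(Z) that are closed in the subspace topology of d(Z). -/
open TopologicalSpace Set

variable {X : Type*} [TopologicalSpace X]

/-- A point of a subspace `S` is closed in `S` iff it has no proper specialization in `S`. -/
theorem isClosed_singleton_subtype_iff {S : Set X} {x : X} (h : x ∈ S) :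
    IsClosed ({⟨x, h⟩} : Set ↥S) ↔ ∀ y ∈ S, y ∈ closure {x} → y = x := by
  rw [← closure_subset_iff_isClosed]
  constructor
  · intro hc y hy hyx
    have : (⟨y, hy⟩ : ↥S) ∈ closure ({⟨x, h⟩} : Set ↥S) := by
      rw [closure_subtype]
      simpa using hyx
    exact congrArg Subtype.val (hc this)
  · rintro hc ⟨y, hy⟩ hyx
    rw [closure_subtype] at hyx
    exact Subtype.ext (hc y hy (by simpa using hyx))

theorem subset_invC (W : Set X) : W ⊆ invC W :=
  subset_sInter fun _ hU => hU.2

/-- In a Noetherian space, the points of `invC W` are the generalizations of points of `W`. -/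
theorem invC_eq_genC [NoetherianSpace X] (W : Set X) : invC W = genC W := by
  ext x
  constructor
  · intro hx
    by_contra hne
    refine hx (closure {x})ᶜ ⟨⟨isClosed_closure.isOpen_compl, NoetherianSpace.isCompact _⟩, ?_⟩
      (subset_closure rfl)
    exact fun w hw hwx => hne ⟨w, hwx, hw⟩
  · rintro ⟨w, hwx, hw⟩ U ⟨⟨hU, -⟩, hWU⟩
    exact (specializes_iff_mem_closure.2 hwx).mem_open hU (hWU hw)

/-- In a Noetherian `T0` space, `ptC W` is the set of closed points of the subspace `W`. -/
theorem ptC_eq_setOf_isClosed [T0Space X] [NoetherianSpace X] (W : Set X) :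
    ptC W = {x : X | ∃ h : x ∈ W, IsClosed ({⟨x, h⟩} : Set ↥W)} := by
  ext x
  simp only [ptC, mem_ofPred_eq, isClosed_singleton_subtype_iff]
  constructor
  · rintro ⟨hx, hc⟩
    obtain ⟨w, hwx, hw⟩ : x ∈ genC W := invC_eq_genC W ▸ hx
    obtain rfl := hc w (subset_invC W hw) hwx
    exact ⟨hw, fun y hy => hc y (subset_invC W hy)⟩
  · rintro ⟨hx, hc⟩
    refine ⟨subset_invC W hx, fun y hy hyx => ?_⟩
    obtain ⟨w, hwy, hw⟩ : y ∈ genC W := invC_eq_genC W ▸ hy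
    have hxy : x ⤳ y := specializes_iff_mem_closure.2 hyx
    have hyw : y ⤳ w := specializes_iff_mem_closure.2 hwy
    obtain rfl := hc w hw (hxy.trans hyw).mem_closure
    exact (hyw.antisymm hxy).eq

/-- If `d : Y → X` is a spectral map between spectral spaces, `X` is Noetherian and `Z ⊆ Y`,
then `pt(d(Z))` is exactly the set of points of `d(Z)` that are closed in the subspace
topology of `d(Z)`. -/
theorem stmt12 {Y : Type*} [TopologicalSpace Y] (hX : IsSpectralTop X) (hY : IsSpectralTop Y)
    (hNoeth : NoetherianSpace X) (d : Y → X) (hd : IsSpectralMap d) (Z : Set Y) :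
    ptC (d '' Z) = {x : X | ∃ h : x ∈ d '' Z, IsClosed ({⟨x, h⟩} : Set ↥(d '' Z))} := by
  have := hX.2.1
  exact ptC_eq_setOf_isClosed _
end

section
/- Let D be a Prüfer domain with quotient field F, let S and T be D-submodules of F, and let V be a valuation subring of F with D ⊆ V. If S ∩ T ⊆ V, then S ⊆ V or T ⊆ V. (Consequently, with 𝔛_M denoting the set of valuation subrings of F containing D and containing the D-submodule M, one has 𝔛_{S ∩ T} = 𝔛_S ∪ 𝔛_T.) -/
/-- If the localization of a domain at a prime `P` is a valuation ring, then of any two elements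
one divides the other up to a factor outside `P`. -/
theorem exists_mul_eq_mul_of_valuationRing_atPrime {D : Type*} [CommRing D] [IsDomain D]
    (P : Ideal D) [P.IsPrime] [ValuationRing (Localization.AtPrime P)] (p q : D) :
    ∃ u v : D, v ∉ P ∧ (p * u = q * v ∨ q * u = p * v) := by
  have key : ∀ (x y : D) (c : Localization.AtPrime P),
      algebraMap D (Localization.AtPrime P) x * c = algebraMap D (Localization.AtPrime P) y →
      ∃ u v : D, v ∉ P ∧ x * u = y * v := by
    intro x y c hc
    obtain ⟨⟨u, v⟩, huv⟩ := IsLocalization.surj P.primeCompl c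
    refine ⟨u, v, v.2, IsLocalization.injective (Localization.AtPrime P)
      P.primeCompl_le_nonZeroDivisors ?_⟩
    rw [map_mul, map_mul, ← huv, ← hc, mul_assoc]
  obtain ⟨c, hc | hc⟩ := ValuationRing.cond (algebraMap D (Localization.AtPrime P) p)
    (algebraMap D (Localization.AtPrime P) q)
  · obtain ⟨u, v, hv, h⟩ := key p q c hc
    exact ⟨u, v, hv, Or.inl h⟩
  · obtain ⟨u, v, hv, h⟩ := key q p c hc
    exact ⟨u, v, hv, Or.inr h⟩

/-- Any two elements of the quotient field of a domain are comparable, up to a factor outside `P`,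
if the localization at the prime `P` is a valuation ring. -/
theorem exists_smul_eq_smul_of_valuationRing_atPrime {F D : Type*} [Field F] [CommRing D]
    [IsDomain D] [Algebra D F] [IsFractionRing D F] (P : Ideal D) [P.IsPrime]
    [ValuationRing (Localization.AtPrime P)] (s t : F) (ht : t ≠ 0) :
    ∃ u v : D, v ∉ P ∧ (v • t = u • s ∨ v • s = u • t) := by
  obtain ⟨p, q, hq, hpq⟩ := IsFractionRing.div_surjective (A := D) (s / t)
  have hq0 : algebraMap D F q ≠ 0 := IsFractionRing.to_map_ne_zero_of_mem_nonZeroDivisors hq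
  rw [div_eq_div_iff hq0 ht] at hpq
  obtain ⟨u, v, hv, h | h⟩ := exists_mul_eq_mul_of_valuationRing_atPrime P p q
  all_goals
    have h' := congrArg (algebraMap D F) h
    rw [map_mul, map_mul] at h'
  · refine ⟨u, v, hv, Or.inl (mul_left_cancel₀ hq0 ?_)⟩
    rw [Algebra.smul_def, Algebra.smul_def]
    linear_combination (-t) * h' + algebraMap D F u * hpq
  · refine ⟨u, v, hv, Or.inr (mul_left_cancel₀ hq0 ?_)⟩
    rw [Algebra.smul_def, Algebra.smul_def]
    linear_combination (-t) * h' - algebraMap D F v * hpq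

/-- A valuation subring `V` containing `D` has a prime center on `D`, and scaling by an element
outside the center does not change membership in `V`. -/
theorem ValuationSubring.exists_prime_forall_mem_of_smul_mem {F D : Type*} [Field F] [CommRing D]
    [Algebra D F] (V : ValuationSubring F) (hV : ∀ d : D, algebraMap D F d ∈ V) :
    ∃ P : Ideal D, P.IsPrime ∧ ∀ v ∉ P, ∀ x : F, v • x ∈ V → x ∈ V := by
  let f : D →+* V := (algebraMap D F).codRestrict V hV
  refine ⟨(IsLocalRing.maximalIdeal V).comap f, inferInstance, fun v hv x hx => ?_⟩
  rw [Ideal.mem_comap, IsLocalRing.mem_maximalIdeal, _root_.mem_nonunits_iff, not_not] at hv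
  obtain ⟨w, hw⟩ := hv.exists_left_inv
  have hw' : (w : F) * algebraMap D F v = 1 := congrArg Subtype.val hw
  have hmem := V.mul_mem _ _ w.2 hx
  rwa [Algebra.smul_def, ← mul_assoc, hw', one_mul] at hmem

/-- Over a Prüfer domain, a valuation overring containing `S ∩ T` contains `S` or `T`. -/
theorem ValuationSubring.submodule_subset_or_of_inter_subset {F D : Type*} [Field F] [CommRing D]
    [IsDomain D] [Algebra D F] [IsFractionRing D F]
    (hPrufer : ∀ (P : Ideal D) [P.IsPrime], ValuationRing (Localization.AtPrime P))
    (S T : Submodule D F) (V : ValuationSubring F) (hV : ∀ d : D, algebraMap D F d ∈ V)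
    (hST : ∀ x : F, x ∈ S → x ∈ T → x ∈ V) : (∀ x ∈ S, x ∈ V) ∨ (∀ x ∈ T, x ∈ V) := by
  by_contra! h
  obtain ⟨⟨s, hs, hsV⟩, t, ht, htV⟩ := h
  obtain ⟨P, hP, hPV⟩ := V.exists_prime_forall_mem_of_smul_mem hV
  have := hPrufer P
  have ht0 : t ≠ 0 := fun h0 => htV (h0 ▸ V.zero_mem)
  obtain ⟨u, v, hv, h | h⟩ := exists_smul_eq_smul_of_valuationRing_atPrime P s t ht0
  · exact htV (hPV v hv t (hST _ (h ▸ S.smul_mem u hs) (T.smul_mem v ht)))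
  · exact hsV (hPV v hv s (hST _ (S.smul_mem v hs) (h ▸ T.smul_mem u ht)))


/-- Let `D` be a Prüfer domain (every localization at a prime is a valuation ring) with
quotient field `F`, let `S` and `T` be `D`-submodules of `F`, and let `V` be a valuation
subring of `F` containing `D`.  If `S ∩ T ⊆ V`, then `S ⊆ V` or `T ⊆ V`.  Consequently, with
`𝔛_M` denoting the set of valuation subrings of `F` containing `D` and containing `M`, one has
`𝔛_{S ∩ T} = 𝔛_S ∪ 𝔛_T`. -/
theorem stmt17 {F D : Type*} [Field F] [CommRing D] [IsDomain D] [Algebra D F]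
    [IsFractionRing D F]
    (hPrufer : ∀ (P : Ideal D) [P.IsPrime], ValuationRing (Localization.AtPrime P))
    (S T : Submodule D F) :
    (∀ V : ValuationSubring F, (∀ d : D, algebraMap D F d ∈ V) →
      (∀ x : F, x ∈ S → x ∈ T → x ∈ V) → (∀ x ∈ S, x ∈ V) ∨ (∀ x ∈ T, x ∈ V)) ∧
    {V : ValuationSubring F | (∀ d : D, algebraMap D F d ∈ V) ∧ ∀ x : F, x ∈ S → x ∈ T → x ∈ V} =
      {V : ValuationSubring F | (∀ d : D, algebraMap D F d ∈ V) ∧ ∀ x ∈ S, x ∈ V} ∪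
        {V : ValuationSubring F | (∀ d : D, algebraMap D F d ∈ V) ∧ ∀ x ∈ T, x ∈ V} := by
  have main := ValuationSubring.submodule_subset_or_of_inter_subset hPrufer S T
  refine ⟨main, Set.ext fun V => ⟨?_, ?_⟩⟩
  · rintro ⟨hV, hST⟩
    exact (main V hV hST).imp (⟨hV, ·⟩) (⟨hV, ·⟩)
  · rintro (⟨hV, h⟩ | ⟨hV, h⟩)
    · exact ⟨hV, fun x hx _ => h x hx⟩
    · exact ⟨hV, fun x _ hx => h x hx⟩
end

section
/- Let A be an integral domain with quotient field F and let t₀, …, t_n be nonzero elements of F. Let I = t₀A + ⋯ + t_nA be the fractional ideal of A generated by t₀, …, t_n, and for each i let (t_iA :_A I) = {a ∈ A : aI ⊆ t_iA}, an ideal of A. Then I is an invertible fractional ideal of A (i.e., there is a fractional ideal J of A with IJ = A) if and only if A = Σ_{i=0}^{n} (t_iA :_A I). -/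
open Submodule

/-- Let `A` be a domain with quotient field `F`, `t₀, …, tₙ` nonzero elements of `F`, and
`I = t₀A + ⋯ + tₙA` the fractional ideal (the `A`-submodule of `F`) they generate.  Then `I`
is invertible (there is an `A`-submodule `J` of `F` with `IJ = A`) if and only if
`A = Σᵢ (tᵢA :_A I)`, where `(tᵢA :_A I) = {a ∈ A : aI ⊆ tᵢA}`. -/
theorem stmt18 {A F : Type*} [CommRing A] [IsDomain A] [Field F] [Algebra A F]
    [IsFractionRing A F] (n : ℕ) (t : Fin (n + 1) → F) (ht : ∀ i, t i ≠ 0) :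
    (∃ J : Submodule A F, span A (Set.range t) * J = 1) ↔
      (∑ i, (span A ({t i} : Set F)).colon (span A (Set.range t))) = (⊤ : Ideal A) := by
  constructor
  · rintro ⟨J, hJ⟩
    have key : span A (Set.range t) * J ≤ Submodule.map (Algebra.linearMap A F)
        (∑ i, (span A ({t i} : Set F)).colon (span A (Set.range t))) := by
      rw [Submodule.mul_le]
      intro m hm j hj
      induction hm using Submodule.span_induction with
      | zero => rw [zero_mul]; exact zero_mem _
      | add x y _ _ hx hy => rw [add_mul]; exact add_mem hx hy
      | smul a x _ hx => rw [smul_mul_assoc]; exact Submodule.smul_mem _ a hx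
      | mem x hx =>
        obtain ⟨i, rfl⟩ := hx
        have h1 : t i * j ∈ (1 : Submodule A F) :=
          hJ ▸ Submodule.mul_mem_mul (subset_span ⟨i, rfl⟩) hj
        obtain ⟨a, ha⟩ := Submodule.mem_one.1 h1
        refine ⟨a, ?_, ha⟩
        have hle := Finset.single_le_sum (f := fun i =>
          (span A ({t i} : Set F)).colon (span A (Set.range t) : Set F))
          (fun _ _ => bot_le) (Finset.mem_univ i)
        refine hle (Submodule.mem_colon.2 fun y hy => ?_)
        have h2 : y * j ∈ (1 : Submodule A F) := hJ ▸ Submodule.mul_mem_mul hy hj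
        obtain ⟨b, hb⟩ := Submodule.mem_one.1 h2
        refine Submodule.mem_span_singleton.2 ⟨b, ?_⟩
        rw [Algebra.smul_def, Algebra.smul_def, ha, hb]
        ring
    rw [hJ] at key
    obtain ⟨a, ha, ha1⟩ := key (Submodule.one_le.1 le_rfl)
    have : a = 1 := IsFractionRing.injective A F (by simpa using ha1)
    exact (Ideal.eq_top_iff_one _).2 (this ▸ ha)
  · intro h
    have h1 : (1 : A) ∈ ∑ i, (span A ({t i} : Set F)).colon (span A (Set.range t)) :=
      h ▸ Submodule.mem_top
    rw [Ideal.sum_eq_sup, Finset.sup_univ_eq_iSup, Submodule.mem_iSup_iff_exists_finsupp] at h1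
    obtain ⟨a, ha, hsum⟩ := h1
    refine ⟨span A (Set.range fun i => algebraMap A F (a i) / t i), le_antisymm ?_ ?_⟩
    · rw [Submodule.span_mul_span, Submodule.span_le]
      rintro _ ⟨_, ⟨k, rfl⟩, _, ⟨i, rfl⟩, rfl⟩
      obtain ⟨b, hb⟩ := Submodule.mem_span_singleton.1
        (Submodule.mem_colon.1 (ha i) (t k) (subset_span ⟨k, rfl⟩))
      rw [Algebra.smul_def, Algebra.smul_def] at hb
      refine Submodule.mem_one.2 ⟨b, ?_⟩
      have := ht i
      field_simp
      rw [mul_comm (t k)]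
      exact hb
    · rw [Submodule.one_le]
      have h2 : (1 : F) = ∑ i, t i * (algebraMap A F (a i) / t i) := by
        rw [← map_one (algebraMap A F), ← hsum, Finsupp.sum_fintype _ _ fun _ => rfl, map_sum]
        exact Finset.sum_congr rfl fun i _ => (mul_div_cancel₀ _ (ht i)).symm
      rw [h2]
      exact Submodule.sum_mem _ fun i _ =>
        Submodule.mul_mem_mul (subset_span ⟨i, rfl⟩) (subset_span ⟨i, rfl⟩)
end

section
/- Let F be a field and let D ⊆ A ⊆ F be subrings. Suppose that for every nonzero t ∈ F there exists a finitely generated D-subalgebra R of F with R ⊆ A such that for every prime ideal Q of R, the localization R_Q (viewed as a subring of F) contains t or contains t⁻¹. Then for every prime ideal P of A the localization A_P (viewed as a subring of F) is a valuation subring of F; in particular, A is a Prüfer domain with quotient field F. -/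
/-- The localization of a subring `A` of a field at a prime ideal `P`, as a subring of the field. -/
def Subring.localizationInField {F : Type*} [Field F] (A : Subring F) (P : Ideal A)
    [hP : P.IsPrime] : Subring F where
  carrier := {x : F | ∃ a s : A, s ∉ P ∧ x = (a : F) / (s : F)}
  zero_mem' := ⟨0, 1, hP.one_notMem, by simp⟩
  one_mem' := ⟨1, 1, hP.one_notMem, by simp⟩
  mul_mem' := by
    rintro _ _ ⟨a, s, hs, rfl⟩ ⟨b, t, ht, rfl⟩
    exact ⟨a * b, s * t, hP.mul_notMem hs ht, by push_cast; exact div_mul_div_comm _ _ _ _⟩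
  neg_mem' := by
    rintro _ ⟨a, s, hs, rfl⟩
    exact ⟨-a, s, hs, by push_cast; exact (neg_div _ _).symm⟩
  add_mem' := by
    rintro _ _ ⟨a, s, hs, rfl⟩ ⟨b, t, ht, rfl⟩
    have hs₀ : (s : F) ≠ 0 := fun e => hs (by simp [Subtype.ext (a2 := (0 : A)) e])
    have ht₀ : (t : F) ≠ 0 := fun e => ht (by simp [Subtype.ext (a2 := (0 : A)) e])
    exact ⟨a * t + s * b, s * t, hP.mul_notMem hs ht, by
      push_cast; exact div_add_div _ _ hs₀ ht₀⟩

/-- Enlarging the subring enlarges the localization at a prime ideal lying under a given one. -/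
theorem Subring.localizationInField_comap_le {F : Type*} [Field F] {R A : Subring F} (hRA : R ≤ A)
    (P : Ideal A) [P.IsPrime] :
    R.localizationInField (P.comap (Subring.inclusion hRA)) ≤ A.localizationInField P := by
  rintro _ ⟨r, s, hs, rfl⟩
  exact ⟨Subring.inclusion hRA r, Subring.inclusion hRA s, hs, rfl⟩


/-- Let `F` be a field and `D ⊆ A ⊆ F` subrings.  Suppose that for every nonzero `t ∈ F` there
is a finitely generated `D`-subalgebra `R` of `F` with `R ⊆ A` such that for every prime ideal
`Q` of `R` the localization `R_Q = {r/s : r ∈ R, s ∈ R ∖ Q}` (viewed inside `F`) contains `t`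
or `t⁻¹`.  Then for every prime ideal `P` of `A` the localization
`A_P = {a/s : a ∈ A, s ∈ A ∖ P}` (viewed inside `F`) is a valuation subring of `F`; in
particular `A` is a Prüfer domain with quotient field `F`. -/
theorem stmt19 {F : Type*} [Field F] (D A : Subring F) (hDA : D ≤ A)
    (h : ∀ t : F, t ≠ 0 → ∃ R : Subring F, D ≤ R ∧ R ≤ A ∧
      (∃ s : Finset F, R = Subring.closure ((D : Set F) ∪ ↑s)) ∧
      ∀ (Q : Ideal ↥R), Q.IsPrime →
        t ∈ {x : F | ∃ r s : ↥R, s ∉ Q ∧ x = (r : F) / (s : F)} ∨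
          t⁻¹ ∈ {x : F | ∃ r s : ↥R, s ∉ Q ∧ x = (r : F) / (s : F)}) :
    (∀ (P : Ideal ↥A), P.IsPrime →
      ∃ V : ValuationSubring F,
        (V : Set F) = {x : F | ∃ a s : ↥A, s ∉ P ∧ x = (a : F) / (s : F)}) ∧
    ∀ x : F, ∃ a b : ↥A, (b : F) ≠ 0 ∧ x = (a : F) / (b : F) := by
  have key (P : Ideal A) [P.IsPrime] (t : F) :
      t ∈ A.localizationInField P ∨ t⁻¹ ∈ A.localizationInField P := by
    rcases eq_or_ne t 0 with rfl | ht
    · exact Or.inl (zero_mem _)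
    · obtain ⟨R, -, hRA, -, hR⟩ := h t ht
      have hle := Subring.localizationInField_comap_le hRA P
      exact (hR (P.comap (Subring.inclusion hRA)) inferInstance).imp (@hle _) (@hle _)
  refine ⟨fun P hP => ⟨⟨A.localizationInField P, key P⟩, rfl⟩, fun x => ?_⟩
  have ne_zero {s : A} (hs : s ∉ (⊥ : Ideal A)) : (s : F) ≠ 0 := by simpa using hs
  rcases eq_or_ne x 0 with rfl | hx
  · exact ⟨0, 1, by simp, by simp⟩
  · rcases key ⊥ x with ⟨a, s, hs, e⟩ | ⟨a, s, hs, e⟩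
    · exact ⟨a, s, ne_zero hs, e⟩
    · refine ⟨s, a, fun ha => hx ?_, ?_⟩
      · simpa [ha] using e
      · rw [← inv_inv x, e, inv_div]
end
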